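/- The free product of two groups each admitting a bi-invariant linear order admits a bi-invariant linear order extending the orders on the factors. -/

import Mathlib

/-- The strictly positive elements of a (not necessarily commutative) linearly ordered ring. -/
structure IsStrictCone {R : Type*} [Ring R] (pos : R → Prop) : Prop where
  not_zero : ¬ pos 0
  add : ∀ {x y}, pos x → pos y → pos (x + y)
  mul : ∀ {x y}, pos x → pos y → pos (x * y)
  total : ∀ x, x ≠ 0 → pos x ∨ pos (-x)

namespace MonoidAlgebra

/-- The coefficient at the largest monomial is positive. -/
def LeadingPos {P : Type*} [LinearOrder P] (x : MonoidAlgebra ℤ P) : Prop :=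
  ∃ p, 0 < x.coeff p ∧ ∀ q, p < q → x.coeff q = 0

theorem isStrictCone_leadingPos {P : Type*} [Monoid P] [LinearOrder P]
    [MulLeftStrictMono P] [MulRightStrictMono P] :
    IsStrictCone (LeadingPos (P := P)) where
  not_zero := by
    rintro ⟨p, hp, -⟩
    simp at hp
  add := by
    rintro x y ⟨p, hp, hp'⟩ ⟨q, hq, hq'⟩
    rcases lt_trichotomy p q with h | rfl | h
    · exact ⟨q, by simpa [hp' q h] using hq, fun r hr ↦ by simp [hp' r (h.trans hr), hq' r hr]⟩
    · exact ⟨p, by simpa using add_pos hp hq, fun r hr ↦ by simp [hp' r hr, hq' r hr]⟩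
    · exact ⟨p, by simpa [hq' p h] using hp, fun r hr ↦ by simp [hq' r (h.trans hr), hp' r hr]⟩
  mul := by
    rintro x y ⟨p, hp, hp'⟩ ⟨q, hq, hq'⟩
    have := mulLeftMono_of_mulLeftStrictMono P
    have := mulRightMono_of_mulRightStrictMono P
    have hx : ∀ a ∈ x.coeff.support, a ≤ p := fun a ha ↦
      le_of_not_gt fun h ↦ Finsupp.mem_support_iff.1 ha (hp' a h)
    have hy : ∀ b ∈ y.coeff.support, b ≤ q := fun b hb ↦
      le_of_not_gt fun h ↦ Finsupp.mem_support_iff.1 hb (hq' b h)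
    refine ⟨p * q, ?_, fun r hr ↦ ?_⟩
    · rw [coeff_mul_mul_of_uniqueMul]
      · exact mul_pos hp hq
      · intro a b ha hb hab
        rcases (hx a ha).lt_or_eq with h | rfl
        · exact absurd hab (mul_lt_mul_of_lt_of_le h (hy b hb)).ne
        · rcases (hy b hb).lt_or_eq with h | rfl
          · exact absurd hab (mul_lt_mul_of_le_of_lt le_rfl h).ne
          · exact ⟨rfl, rfl⟩
    · classical
      rw [coeff_mul]
      refine Finset.sum_eq_zero fun a ha ↦ Finset.sum_eq_zero fun b hb ↦ if_neg ?_
      rintro rfl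
      exact hr.not_ge (mul_le_mul' (hx a ha) (hy b hb))
  total := by
    intro x hx
    have hs : x.coeff.support.Nonempty := by simpa using hx
    have hmax : ∀ q, x.coeff.support.max' hs < q → x.coeff q = 0 := fun q hq ↦ by
      by_contra h
      exact hq.not_ge (Finset.le_max' _ _ (Finsupp.mem_support_iff.2 h))
    rcases lt_or_gt_of_ne (Finsupp.mem_support_iff.1 (Finset.max'_mem _ hs)) with h | h
    · exact .inr ⟨_, by simpa using h, fun q hq ↦ by simpa using hmax q hq⟩
    · exact .inl ⟨_, h, hmax⟩

theorem leadingPos_single {P : Type*} [LinearOrder P] (p : P) :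
    LeadingPos (single p (1 : ℤ)) :=
  ⟨p, by simp, fun q hq ↦ by simp [hq.ne]⟩

theorem leadingPos_single_sub_single {P : Type*} [LinearOrder P] {p q : P}
    (h : p < q) : LeadingPos (single q (1 : ℤ) - single p 1) :=
  ⟨q, by simp [h.ne], fun r hr ↦ by simp [hr.ne, (h.trans hr).ne]⟩

end MonoidAlgebra

namespace PowerSeries

/-- The lowest nonzero coefficient satisfies `pos`. -/
def LowestPos {R : Type*} [Ring R] (pos : R → Prop) (F : PowerSeries R) : Prop :=
  ∃ n, pos (coeff n F) ∧ ∀ m < n, coeff m F = 0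

theorem isStrictCone_lowestPos {R : Type*} [Ring R] {pos : R → Prop}
    (hpos : IsStrictCone pos) : IsStrictCone (LowestPos pos) where
  not_zero := by
    rintro ⟨n, hn, -⟩
    exact hpos.not_zero (by simpa using hn)
  add := by
    rintro F H ⟨m, hm, hm'⟩ ⟨n, hn, hn'⟩
    rcases lt_trichotomy m n with h | rfl | h
    · exact ⟨m, by simpa [hn' m h] using hm, fun r hr ↦ by simp [hn' r (hr.trans h), hm' r hr]⟩
    · exact ⟨m, by simpa using hpos.add hm hn, fun r hr ↦ by simp [hm' r hr, hn' r hr]⟩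
    · exact ⟨n, by simpa [hm' n h] using hn, fun r hr ↦ by simp [hm' r (hr.trans h), hn' r hr]⟩
  mul := by
    rintro F H ⟨m, hm, hm'⟩ ⟨n, hn, hn'⟩
    refine ⟨m + n, ?_, fun r hr ↦ ?_⟩
    · rw [coeff_mul, Finset.sum_eq_single (m, n)]
      · exact hpos.mul hm hn
      · rintro ⟨i, j⟩ hij hne
        rw [Finset.HasAntidiagonal.mem_antidiagonal] at hij
        rcases lt_or_ge i m with h | h
        · simp [hm' i h]
        · have : j < n := by
            by_contra hj
            exact hne (Prod.ext (by grind) (by grind))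
          simp [hn' j this]
      · simp
    · rw [coeff_mul]
      refine Finset.sum_eq_zero fun ij hij ↦ ?_
      rw [Finset.HasAntidiagonal.mem_antidiagonal] at hij
      rcases lt_or_ge ij.1 m with h | h
      · simp [hm' _ h]
      · simp [hn' ij.2 (by omega)]
  total := by
    classical
    intro F hF
    have hex : ∃ n, coeff n F ≠ 0 := by
      by_contra! h
      exact hF (PowerSeries.ext (by simpa using h))
    have hmin : ∀ m < Nat.find hex, coeff m F = 0 := fun m hm ↦ by
      simpa using Nat.find_min hex hm
    rcases hpos.total _ (Nat.find_spec hex) with h | h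
    · exact .inl ⟨_, h, hmin⟩
    · exact .inr ⟨_, by simpa using h, fun m hm ↦ by simpa using hmin m hm⟩

theorem LowestPos.of_constantCoeff {R : Type*} [Ring R] {pos : R → Prop} {F : PowerSeries R}
    (h : pos (constantCoeff F)) : LowestPos pos F :=
  ⟨0, by simpa using h, by simp⟩

/-- The unit `1 + c X` of the ring of power series. -/
noncomputable def oneAddMulX {R : Type*} [Ring R] (c : R) : (PowerSeries R)ˣ where
  val := 1 + X * C c
  inv := mk fun n ↦ (-c) ^ n
  val_inv := by
    ext n
    cases n with
    | zero => simp [add_mul, mul_assoc]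
    | succ n =>
      rw [add_mul, map_add, one_mul, mul_assoc, coeff_succ_X_mul, coeff_C_mul, coeff_mk, coeff_mk,
        pow_succ', coeff_one]
      simp
  inv_val := by
    ext n
    cases n with
    | zero => simp [mul_add, X_mul, ← mul_assoc]
    | succ n =>
      rw [X_mul, mul_add, map_add, mul_one, ← mul_assoc, coeff_succ_mul_X, coeff_mul_C, coeff_mk,
        coeff_mk, pow_succ, coeff_one]
      simp

end PowerSeries

/-- The monoid of pairs of a sequence in `G` and a natural number, the latter acting on sequences
by shifting them to the right. -/
@[ext] structure ShiftMonoid (G : Type*) where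
  /-- The exponent of the shift. -/
  shift : ℕ
  /-- The sequence. -/
  label : ℕ → G

namespace ShiftMonoid

variable {G : Type*} [Group G]

instance : Mul (ShiftMonoid G) where
  mul x y := ⟨x.shift + y.shift,
    fun i ↦ x.label i * if x.shift ≤ i then y.label (i - x.shift) else 1⟩

instance : One (ShiftMonoid G) := ⟨⟨0, 1⟩⟩

@[simp] theorem shift_mul (x y : ShiftMonoid G) : (x * y).shift = x.shift + y.shift := rfl

theorem label_mul (x y : ShiftMonoid G) (i : ℕ) :
    (x * y).label i = x.label i * if x.shift ≤ i then y.label (i - x.shift) else 1 := rfl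

@[simp] theorem shift_one : (1 : ShiftMonoid G).shift = 0 := rfl

@[simp] theorem label_one : (1 : ShiftMonoid G).label = 1 := rfl

instance : Monoid (ShiftMonoid G) where
  mul_assoc x y z := by
    ext i
    · simp [add_assoc]
    · simp only [label_mul, shift_mul]
      split_ifs <;> first | omega | simp [mul_assoc, Nat.sub_sub]
  one_mul x := by ext <;> simp [label_mul]
  mul_one x := by ext <;> simp [label_mul]

/-- A group element as the zeroth term of a sequence. -/
def of : G →* ShiftMonoid G where
  toFun g := ⟨0, Pi.mulSingle 0 g⟩
  map_one' := by ext <;> simp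
  map_mul' g h := by ext <;> simp [label_mul, Pi.mulSingle_mul]

/-- The shift. -/
def gen : ShiftMonoid G := ⟨1, 1⟩

@[simp] theorem shift_of (g : G) : (of g).shift = 0 := rfl

theorem label_of (g : G) : (of g).label = Pi.mulSingle 0 g := rfl

@[simp] theorem shift_gen : (gen : ShiftMonoid G).shift = 1 := rfl

@[simp] theorem label_gen : (gen : ShiftMonoid G).label = 1 := rfl

noncomputable instance {G : Type*} [LinearOrder G] : LinearOrder (ShiftMonoid G) :=
  LinearOrder.lift' (fun x ↦ (toLex (x.shift, toLex x.label) : ℕ ×ₗ Lex (ℕ → G)))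
    fun x y h ↦ by simpa [ShiftMonoid.ext_iff] using h

theorem lt_iff {G : Type*} [LinearOrder G] {x y : ShiftMonoid G} : x < y ↔ x.shift < y.shift ∨
    x.shift = y.shift ∧ ∃ i, (∀ j < i, x.label j = y.label j) ∧ x.label i < y.label i :=
  Prod.Lex.lt_iff

variable [LinearOrder G]

theorem of_strictMono : StrictMono (of : G → ShiftMonoid G) := fun g h hgh ↦
  lt_iff.2 (.inr ⟨rfl, 0, by simp, by simpa [label_of] using hgh⟩)

variable [MulLeftStrictMono G] [MulRightStrictMono G]

instance : MulLeftStrictMono (ShiftMonoid G) where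
  elim u x y h := by
    change u * x < u * y
    rw [lt_iff]
    obtain h | ⟨h, i, hi, hlt⟩ := lt_iff.1 h
    · exact .inl (by simpa using h)
    · refine .inr ⟨by simpa using h, i + u.shift, fun j hj ↦ ?_, ?_⟩
      · simp only [label_mul]
        split_ifs with hu
        · rw [hi _ (by omega)]
        · rfl
      · simpa [label_mul] using hlt

instance : MulRightStrictMono (ShiftMonoid G) where
  elim u x y h := by
    change x * u < y * u
    rw [lt_iff]
    obtain h | ⟨h, i, hi, hlt⟩ := lt_iff.1 h
    · exact .inl (by simpa using h)
    · refine .inr ⟨by simpa using h, i, fun j hj ↦ ?_, ?_⟩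
      · simp only [label_mul, h, hi j hj]
      · simp only [label_mul, h]
        exact mul_lt_mul_left hlt _

end ShiftMonoid

namespace ShiftMonoid

open PowerSeries

variable {G : Type*} [Group G]

/-- The power series ring over the monoid ring of `ShiftMonoid G`. -/
abbrev Series (G : Type*) [Group G] : Type _ := PowerSeries (MonoidAlgebra ℤ (ShiftMonoid G))

/-- The constant power series given by a group element. -/
noncomputable def const : G →* Series G :=
  (C : MonoidAlgebra ℤ (ShiftMonoid G) →+* Series G).toMonoidHom.comp
    ((MonoidAlgebra.of ℤ (ShiftMonoid G)).comp of)

theorem const_apply (g : G) : const g = C (MonoidAlgebra.single (of g) 1) := rfl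

/-- The unit `1 + X σ`, where `σ` is the shift. -/
noncomputable def conjUnit (G : Type*) [Group G] : (Series G)ˣ :=
  oneAddMulX (MonoidAlgebra.single gen 1)

/-- The coefficient of a power series at `X ^ n` and at the monomial of shift `n` and label `f`. -/
noncomputable def diagCoeff (F : Series G) (n : ℕ) (f : ℕ → G) : ℤ :=
  (coeff n F).coeff ⟨n, f⟩

theorem diagCoeff_const_mul (g : G) (F : Series G) (n : ℕ) (f : ℕ → G) :
    diagCoeff (const g * F) n f = diagCoeff F n (Pi.mulSingle 0 g⁻¹ * f) := by
  rw [diagCoeff, const_apply, coeff_C_mul,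
    MonoidAlgebra.coeff_single_mul_eq_mul_coeff (m₂ := ⟨n, Pi.mulSingle 0 g⁻¹ * f⟩), one_mul,
    diagCoeff]
  intro d _
  have key : (⟨n, Pi.mulSingle 0 g⁻¹ * f⟩ : ShiftMonoid G) = of g⁻¹ * ⟨n, f⟩ := by
    ext i <;> simp [label_mul, label_of]
  rw [key]
  constructor
  · intro h
    rw [← h, ← mul_assoc, ← map_mul, inv_mul_cancel, map_one, one_mul]
  · rintro rfl
    rw [← mul_assoc, ← map_mul, mul_inv_cancel, map_one, one_mul]

theorem diagCoeff_conjUnit_mul_zero (F : Series G) (f : ℕ → G) :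
    diagCoeff ((conjUnit G : Series G) * F) 0 f = diagCoeff F 0 f := by
  simp [diagCoeff, conjUnit, oneAddMulX, add_mul, mul_assoc]

open scoped Classical in
theorem diagCoeff_conjUnit_mul_succ (F : Series G) (n : ℕ) (f : ℕ → G) :
    diagCoeff ((conjUnit G : Series G) * F) (n + 1) f = diagCoeff F (n + 1) f +
      if f 0 = 1 then diagCoeff F n (fun i ↦ f (i + 1)) else 0 := by
  simp only [diagCoeff, conjUnit, oneAddMulX, add_mul, mul_assoc, one_mul, map_add,
    coeff_succ_X_mul, coeff_C_mul, MonoidAlgebra.coeff_add, Finsupp.add_apply]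
  congr 1
  split_ifs with h
  · rw [MonoidAlgebra.coeff_single_mul_eq_mul_coeff (m₂ := ⟨n, fun i ↦ f (i + 1)⟩), one_mul]
    intro d _
    constructor
    · intro hd
      ext i
      · have := congrArg shift hd
        simpa [add_comm] using this
      · simpa [label_mul] using congrFun (congrArg label hd) (i + 1)
    · rintro rfl
      ext i
      · simp [add_comm]
      · cases i <;> simp [label_mul, h]
  · apply MonoidAlgebra.coeff_single_mul_of_forall_mul_ne
    intro d hd
    exact h (by simpa [label_mul] using (congrFun (congrArg label hd) 0).symm)

/-- The terms strictly between positions `0` and `n` are nontrivial. -/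
def IsReduced (n : ℕ) (f : ℕ → G) : Prop := ∀ i, 0 < i → i < n → f i ≠ 1

theorem IsReduced.tail {n : ℕ} {f : ℕ → G} (hf : IsReduced (n + 1) f) :
    IsReduced n fun i ↦ f (i + 1) := fun i _ hi ↦ hf (i + 1) (by omega) (by omega)

open scoped Classical in
theorem diagCoeff_conjUnit_inv_mul_succ (F : Series G) (n : ℕ) {f : ℕ → G}
    (hf : IsReduced (n + 1) f) :
    diagCoeff ((↑(conjUnit G)⁻¹ : Series G) * F) (n + 1) f = diagCoeff F (n + 1) f -
      if f 0 = 1 then diagCoeff F n (fun i ↦ f (i + 1)) else 0 := by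
  obtain ⟨H, rfl⟩ : ∃ H, F = (conjUnit G : Series G) * H :=
    ⟨(↑(conjUnit G)⁻¹ : Series G) * F, by simp⟩
  rw [Units.inv_mul_cancel_left, diagCoeff_conjUnit_mul_succ]
  cases n with
  | zero => simp [diagCoeff_conjUnit_mul_zero]
  | succ n => simp [diagCoeff_conjUnit_mul_succ, hf 1 (by omega) (by omega)]

/-- The reduced coefficients of `F` vanish above degree `d`, and a reduced coefficient of degree
`d` whose label begins with `g` does not. -/
def HasTop (F : Series G) (d : ℕ) (g : G) : Prop :=
  (∀ n, d < n → ∀ f, IsReduced n f → diagCoeff F n f = 0) ∧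
    ∃ f, IsReduced d f ∧ f 0 = g ∧ diagCoeff F d f ≠ 0

theorem hasTop_one : HasTop (1 : Series G) 0 1 := by
  refine ⟨fun n hn f _ ↦ ?_, 1, fun i _ hi ↦ by omega, rfl, ?_⟩
  · simp [diagCoeff, coeff_one, hn.ne']
  · have : (⟨0, 1⟩ : ShiftMonoid G) = 1 := rfl
    simp [diagCoeff, this]

theorem HasTop.ne_one {F : Series G} {d : ℕ} {g : G} (h : HasTop F d g) (hd : d ≠ 0) : F ≠ 1 := by
  rintro rfl
  obtain ⟨f, hf, -, hne⟩ := h.2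
  exact hne (hasTop_one.1 d (by omega) f hf)

theorem HasTop.const_mul {F : Series G} {d : ℕ} {g : G} (h : HasTop F d g) (u : G) :
    HasTop (const u * F) d (u * g) := by
  have hred : ∀ (v : G) n (f : ℕ → G), IsReduced n f → IsReduced n (Pi.mulSingle 0 v * f) :=
    fun v n f hf i hi hin ↦ by
      rw [Pi.mul_apply, Pi.mulSingle_eq_of_ne hi.ne', one_mul]
      exact hf i hi hin
  obtain ⟨hvan, f, hf, rfl, hne⟩ := h
  refine ⟨fun n hn f hf ↦ ?_, Pi.mulSingle 0 u * f, hred _ _ _ hf, by simp, ?_⟩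
  · rw [diagCoeff_const_mul]
    exact hvan n hn _ (hred _ _ _ hf)
  · rwa [diagCoeff_const_mul, ← mul_assoc, ← Pi.mulSingle_mul, inv_mul_cancel, Pi.mulSingle_one,
      one_mul]

open scoped Classical in
theorem HasTop.succ {F H : Series G} {d : ℕ} {g : G} (h : HasTop F d g) (hg : g ≠ 1 ∨ d = 0)
    {ε : ℤ} (hε : ε ≠ 0)
    (hH : ∀ n f, IsReduced (n + 1) f → diagCoeff H (n + 1) f = diagCoeff F (n + 1) f +
      ε * if f 0 = 1 then diagCoeff F n (fun i ↦ f (i + 1)) else 0) :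
    HasTop H (d + 1) 1 := by
  obtain ⟨hvan, f, hf, rfl, hne⟩ := h
  refine ⟨fun n hn f hf ↦ ?_, fun i ↦ Nat.casesOn i 1 f, ?_, rfl, ?_⟩
  · obtain ⟨n, rfl⟩ : ∃ m, n = m + 1 := ⟨n - 1, by omega⟩
    rw [hH n f hf, hvan (n + 1) (by omega) f hf, hvan n (by omega) _ hf.tail]
    simp
  all_goals
    have hred : IsReduced (d + 1) (fun i ↦ Nat.casesOn i 1 f : ℕ → G) := by
      rintro (_ | _ | i) hi hid
      · omega
      · exact hg.resolve_right (by omega)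
      · exact hf (i + 1) (by omega) (by omega)
  · exact hred
  · rw [hH d _ hred, hvan (d + 1) (by omega) _ hred]
    simpa [hε] using hne

theorem HasTop.conjUnit_mul {F : Series G} {d : ℕ} {g : G} (h : HasTop F d g)
    (hg : g ≠ 1 ∨ d = 0) : HasTop ((conjUnit G : Series G) * F) (d + 1) 1 :=
  h.succ hg one_ne_zero fun n f _ ↦ by rw [diagCoeff_conjUnit_mul_succ, one_mul]

theorem HasTop.conjUnit_inv_mul {F : Series G} {d : ℕ} {g : G} (h : HasTop F d g)
    (hg : g ≠ 1 ∨ d = 0) : HasTop ((↑(conjUnit G)⁻¹ : Series G) * F) (d + 1) 1 :=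
  h.succ hg (neg_ne_zero.2 one_ne_zero) fun n f hf ↦ by
    rw [diagCoeff_conjUnit_inv_mul_succ F n hf, neg_one_mul, sub_eq_add_neg]

variable {A B : Type*} [Group A] [Group B]

/-- The homomorphism from the free product that sends the left factor to constants and the right
factor to the conjugates of constants by `conjUnit`. -/
noncomputable def coprodHom (i : A →* G) (j : B →* G) : Monoid.Coprod A B →* Series G :=
  Monoid.Coprod.lift (const.comp i)
    { toFun b := conjUnit G * const (j b) * ↑(conjUnit G)⁻¹
      map_one' := by simp
      map_mul' x y := by simp [mul_assoc] }

@[simp] theorem coprodHom_inl (i : A →* G) (j : B →* G) (a : A) :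
    coprodHom i j (.inl a) = const (i a) := by
  simp [coprodHom]

@[simp] theorem coprodHom_inr (i : A →* G) (j : B →* G) (b : B) :
    coprodHom i j (.inr b) = conjUnit G * const (j b) * ↑(conjUnit G)⁻¹ := by
  simp [coprodHom]

end ShiftMonoid

namespace Monoid.Coprod

variable {A B : Type*} [Group A] [Group B]

/-- `IsNormal x a k` says that `x` is an alternating product of elements of `A` and `B`, beginning
with `a : A` and ending in `A`, with `k` factors from `B`, all of whose factors are nontrivial
except possibly for the first and the last one. -/
inductive IsNormal : Coprod A B → A → ℕ → Prop
  | inl (a : A) : IsNormal (.inl a) a 0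
  | step (a : A) {b : B} {y : Coprod A B} {a' : A} {k : ℕ} (hb : b ≠ 1) (hy : IsNormal y a' k)
      (ha' : a' ≠ 1 ∨ k = 0) : IsNormal (.inl a * .inr b * y) a (k + 1)

theorem IsNormal.inl_mul {x : Coprod A B} {a : A} {k : ℕ} (h : IsNormal x a k) (c : A) :
    IsNormal (.inl c * x) (c * a) k := by
  cases h with
  | inl a => simpa using IsNormal.inl (B := B) (c * a)
  | step a hb hy ha' => simpa [mul_assoc] using IsNormal.step (c * a) hb hy ha'

theorem exists_isNormal (x : Coprod A B) : ∃ a k, IsNormal x a k := by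
  induction x using Monoid.Coprod.induction_on' with
  | one => exact ⟨1, 0, by simpa using IsNormal.inl (B := B) (1 : A)⟩
  | inl_mul c x ih =>
    obtain ⟨a, k, h⟩ := ih
    exact ⟨_, _, h.inl_mul c⟩
  | inr_mul c x ih =>
    obtain ⟨a, k, h⟩ := ih
    by_cases hc : c = 1
    · exact ⟨a, k, by simpa [hc] using h⟩
    by_cases hak : a ≠ 1 ∨ k = 0
    · exact ⟨1, k + 1, by simpa using IsNormal.step 1 hc h hak⟩
    · cases h with
      | inl a => simp at hak
      | @step a b y a' k hb hy ha' =>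
        obtain rfl : a = 1 := by simpa using hak
        by_cases hcb : c * b = 1
        · exact ⟨a', k, by simpa [← mul_assoc, ← map_mul, hcb] using hy⟩
        · exact ⟨1, k + 1, by simpa [mul_assoc] using IsNormal.step 1 hcb hy ha'⟩

end Monoid.Coprod

namespace ShiftMonoid

open PowerSeries MonoidAlgebra

variable {G A B : Type*} [Group G] [Group A] [Group B]

theorem hasTop_coprodHom {i : A →* G} {j : B →* G} (hi : Function.Injective i)
    (hj : Function.Injective j) {x : Monoid.Coprod A B} {a : A} {k : ℕ} (hx : x.IsNormal a k) :
    HasTop (coprodHom i j x) (2 * k) (i a) := by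
  induction hx with
  | inl a => simpa using hasTop_one.const_mul (i a)
  | @step a b y a' k hb _ ha' ih =>
    have h1 := ih.conjUnit_inv_mul (ha'.imp (by simpa [map_eq_one_iff i hi] using ·) (by simp [·]))
    have h2 := (h1.const_mul (j b)).conjUnit_mul (.inl (by simpa [map_eq_one_iff j hj] using hb))
    simpa [mul_assoc, mul_add] using h2.const_mul (i a)

theorem const_injective : Function.Injective (const : G →* Series G) := fun g h hgh ↦ by
  have := of_injective (R := ℤ) (C_injective hgh)
  simpa [label_of] using congrFun (congrArg label this) 0

theorem coprodHom_injective {i : A →* G} {j : B →* G} (hi : Function.Injective i)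
    (hj : Function.Injective j) : Function.Injective (coprodHom i j) := by
  rw [injective_iff_map_eq_one]
  intro x hx
  obtain ⟨a, k, h⟩ := x.exists_isNormal
  obtain rfl | hk := eq_or_ne k 0
  · cases h
    rw [coprodHom_inl, map_eq_one_iff _ const_injective, map_eq_one_iff i hi] at hx
    rw [hx, map_one]
  · exact absurd hx ((hasTop_coprodHom hi hj h).ne_one (by omega))

variable [LinearOrder G] [MulLeftStrictMono G] [MulRightStrictMono G]

theorem lowestPos_coprodHom (i : A →* G) (j : B →* G) (x : Monoid.Coprod A B) :
    LowestPos LeadingPos (coprodHom i j x) := by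
  have hcone := isStrictCone_lowestPos (isStrictCone_leadingPos (P := ShiftMonoid G))
  have hconst (g : G) : LowestPos LeadingPos (const g) :=
    .of_constantCoeff (by simpa [const_apply] using leadingPos_single _)
  induction x using Monoid.Coprod.induction_on with
  | inl a => simpa using hconst (i a)
  | inr b =>
    rw [coprodHom_inr]
    refine hcone.mul (hcone.mul (.of_constantCoeff ?_) (hconst _)) (.of_constantCoeff ?_)
    all_goals simpa [conjUnit, oneAddMulX, one_def] using leadingPos_single (1 : ShiftMonoid G)
  | mul x y hx hy => simpa using hcone.mul hx hy

end ShiftMonoid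

theorem IsStrictCone.exists_linearOrder {K R : Type*} [Group K] [Ring R] {pos : R → Prop}
    (hpos : IsStrictCone pos) {φ : K →* R} (hφ : Function.Injective φ) :
    ∃ lo : LinearOrder K, ∀ x y, lo.lt x y ↔ pos (φ y - φ x) := by
  classical
  have : IsStrictTotalOrder K fun x y ↦ pos (φ y - φ x) :=
    { irrefl x h := hpos.not_zero (by simpa using h)
      trans x y z hxy hyz := by simpa using hpos.add hyz hxy
      trichotomous x y hxy hyx := by
        by_contra hne
        rcases hpos.total (φ y - φ x) (sub_ne_zero.2 (hφ.ne (Ne.symm hne))) with h | h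
        · exact hxy h
        · exact hyx (by simpa using h) }
  exact ⟨linearOrderOfSTO fun x y ↦ pos (φ y - φ x), fun x y ↦ Iff.rfl⟩

/-- A free product of groups that embed in a bi-ordered group has a bi-order inducing the orders
pulled back to the factors. -/
theorem Monoid.Coprod.exists_biorder {G A B : Type*} [Group G] [LinearOrder G]
    [MulLeftStrictMono G] [MulRightStrictMono G] [Group A] [Group B] [LinearOrder A]
    [LinearOrder B] {i : A →* G} {j : B →* G} (hi : StrictMono i) (hj : StrictMono j) :
    ∃ lo : LinearOrder (Monoid.Coprod A B),
      (∀ a b x y : Monoid.Coprod A B, lo.lt x y → lo.lt (a * x * b) (a * y * b)) ∧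
      (∀ x y : A, x < y ↔ lo.lt (Monoid.Coprod.inl x) (Monoid.Coprod.inl y)) ∧
      (∀ x y : B, x < y ↔ lo.lt (Monoid.Coprod.inr x) (Monoid.Coprod.inr y)) := by
  have hcone := PowerSeries.isStrictCone_lowestPos
    (MonoidAlgebra.isStrictCone_leadingPos (P := ShiftMonoid G))
  obtain ⟨lo, hlo⟩ := hcone.exists_linearOrder
    (ShiftMonoid.coprodHom_injective hi.injective hj.injective)
  refine ⟨lo, fun a b x y h ↦ ?_, fun x y ↦ ?_, fun x y ↦ ?_⟩
  · rw [hlo] at h ⊢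
    simpa [mul_sub, sub_mul] using hcone.mul (hcone.mul
      (ShiftMonoid.lowestPos_coprodHom i j a) h) (ShiftMonoid.lowestPos_coprodHom i j b)
  · have hmono : StrictMono (Monoid.Coprod.inl : A →* Monoid.Coprod A B) := fun x y h ↦ by
      refine (hlo _ _).2 (.of_constantCoeff ?_)
      simpa [ShiftMonoid.const_apply] using
        MonoidAlgebra.leadingPos_single_sub_single (ShiftMonoid.of_strictMono (hi h))
    exact hmono.lt_iff_lt.symm
  · have hmono : StrictMono (Monoid.Coprod.inr : B →* Monoid.Coprod A B) := fun x y h ↦ by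
      refine (hlo _ _).2 (.of_constantCoeff ?_)
      simpa [ShiftMonoid.const_apply, ShiftMonoid.conjUnit, PowerSeries.oneAddMulX] using
        MonoidAlgebra.leadingPos_single_sub_single (ShiftMonoid.of_strictMono (hj h))
    exact hmono.lt_iff_lt.symm

theorem free_product_biorderable (A B : Type*) [Group A] [Group B]
    [LinearOrder A] [LinearOrder B]
    (hA : ∀ u v x y : A, x < y → u * x * v < u * y * v)
    (hB : ∀ u v x y : B, x < y → u * x * v < u * y * v) :
    ∃ lo : LinearOrder (Monoid.Coprod A B),
      (∀ a b x y : Monoid.Coprod A B, lo.lt x y → lo.lt (a * x * b) (a * y * b)) ∧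
      (∀ x y : A, x < y ↔ lo.lt (Monoid.Coprod.inl x) (Monoid.Coprod.inl y)) ∧
      (∀ x y : B, x < y ↔ lo.lt (Monoid.Coprod.inr x) (Monoid.Coprod.inr y)) := by
  have hlA (u x y : A) (h : x < y) : u * x < u * y := by simpa using hA u 1 x y h
  have hrA (u x y : A) (h : x < y) : x * u < y * u := by simpa using hA 1 u x y h
  have hlB (u x y : B) (h : x < y) : u * x < u * y := by simpa using hB u 1 x y h
  have hrB (u x y : B) (h : x < y) : x * u < y * u := by simpa using hB 1 u x y h
  have : MulLeftStrictMono (A ×ₗ B) := ⟨fun u x y h ↦ by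
    rw [Prod.Lex.lt_iff] at h ⊢
    exact h.imp (hlA _ _ _) (.imp (congrArg (u.1 * ·)) (hlB _ _ _))⟩
  have : MulRightStrictMono (A ×ₗ B) := ⟨fun u x y h ↦ by
    rw [Prod.Lex.lt_iff] at h ⊢
    exact h.imp (hrA _ _ _) (.imp (congrArg (· * u.1)) (hrB _ _ _))⟩
  refine Monoid.Coprod.exists_biorder (G := A ×ₗ B)
    (i := (toLexMulEquiv (A × B)).toMonoidHom.comp (MonoidHom.inl A B))
    (j := (toLexMulEquiv (A × B)).toMonoidHom.comp (MonoidHom.inr A B)) ?_ ?_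
  · exact fun x y h ↦ Prod.Lex.lt_iff.2 (.inl h)
  · exact fun x y h ↦ Prod.Lex.lt_iff.2 (.inr ⟨rfl, h⟩)
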